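/- Let C_L > C_R, let U be a bounded entropy solution admitting one-sided spatial limits, and let η be smooth with η″ > 0. Assume x_L, x_R : [0,∞) → ℝ are Filippov solutions of ẋ_L(t) ∈ [f(U(x_L(t)+,t),C_L), f(U(x_L(t)−,t),C_L)] and ẋ_R(t) ∈ [f(U(x_R(t)+,t),C_R), f(U(x_R(t)−,t),C_R)] with x_L(0) = x_R(0) = 0. Then x_R(t) ≤ x_L(t) for all t ≥ 0. -/

import Mathlib

open MeasureTheory Set Filter Topology

noncomputable section

/-- The Riemann data `φ` with left state `CL` and right state `CR`. -/
def riemann (CL CR : ℝ) (x : ℝ) : ℝ := if x < 0 then CL else CR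

/-- The relative entropy `η(v | C) = η(v) - η(C) - η'(C)(v - C)`. -/
def relEnt (η : ℝ → ℝ) (v C : ℝ) : ℝ := η v - η C - deriv η C * (v - C)

/-- The relative entropy flux `F(v, C) = ∫_C^v (η'(w) - η'(C)) A'(w) dw`. -/
def relFlux (A η : ℝ → ℝ) (v C : ℝ) : ℝ := ∫ w in C..v, (deriv η w - deriv η C) * deriv A w

/-- The normalized relative entropy flux `f(v, C) = F(v, C) / η(v | C)` for `v ≠ C`,
extended by `f(C, C) = A'(C)` on the diagonal. -/
def normFlux (A η : ℝ → ℝ) (v C : ℝ) : ℝ :=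
  if v = C then deriv A C else relFlux A η v C / relEnt η v C

/-- `U` is a bounded measurable entropy solution of `∂ₜ U + ∂ₓ A(U) = 0` on `ℝ × (0, ∞)`:
for every entropy/entropy-flux pair `(η, G)` with `η'' ≥ 0` and `G' = η' A'`, and every
nonnegative smooth compactly supported test function `θ` vanishing for `t ≤ 0`, one has
`∫₀^∞ ∫_ℝ (η(U) ∂ₜθ + G(U) ∂ₓθ) dx dt ≥ 0`. -/
structure IsEntropySol (A : ℝ → ℝ) (U : ℝ → ℝ → ℝ) : Prop where
  bounded : ∃ M, ∀ x t, |U x t| ≤ M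
  measurable : Measurable fun p : ℝ × ℝ => U p.1 p.2
  entropy : ∀ η G : ℝ → ℝ, ContDiff ℝ (⊤ : ℕ∞) η → ContDiff ℝ (⊤ : ℕ∞) G →
    (∀ v, 0 ≤ deriv (deriv η) v) → (∀ v, deriv G v = deriv η v * deriv A v) →
    ∀ θ : ℝ → ℝ → ℝ, ContDiff ℝ (⊤ : ℕ∞) (fun p : ℝ × ℝ => θ p.1 p.2) →
      HasCompactSupport (fun p : ℝ × ℝ => θ p.1 p.2) →
      (∀ x t, 0 ≤ θ x t) → (∀ x t, t ≤ 0 → θ x t = 0) →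
      0 ≤ ∫ t in Ioi (0 : ℝ), ∫ x : ℝ,
        (η (U x t) * deriv (fun s => θ x s) t + G (U x t) * deriv (fun y => θ y t) x)

/-- `Um x t = U(x-, t)` and `Up x t = U(x+, t)` are the one-sided spatial limits of `U`,
satisfying `U(x-, t) ≥ U(x+, t)` for all `x` and all `t > 0`. -/
structure HasSideLimits (U Um Up : ℝ → ℝ → ℝ) : Prop where
  left : ∀ x t : ℝ, 0 < t → Tendsto (fun y => U y t) (𝓝[<] x) (𝓝 (Um x t))
  right : ∀ x t : ℝ, 0 < t → Tendsto (fun y => U y t) (𝓝[>] x) (𝓝 (Up x t))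
  mono : ∀ x t : ℝ, 0 < t → Up x t ≤ Um x t

/-- `t ↦ U(·, t)` is continuous from `[0, ∞)` into `L¹_loc(ℝ)`. -/
def L1locCont (U : ℝ → ℝ → ℝ) : Prop :=
  ∀ R > (0 : ℝ), ∀ t₀ ≥ (0 : ℝ),
    Tendsto (fun t => ∫ x in (-R)..R, |U x t - U x t₀|) (𝓝[≥] t₀) (𝓝 0)

/-- `x` is a Filippov solution on the set `s` of the differential inclusion
`ẋ(t) ∈ [f(U(x(t)+, t), C), f(U(x(t)-, t), C)]`, where `f` is the normalized relative
entropy flux: `x` is Lipschitz on `s` and for a.e. `t ∈ s` it has a derivative lying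
in the prescribed interval. -/
def IsFilippov (A η : ℝ → ℝ) (Um Up : ℝ → ℝ → ℝ) (C : ℝ) (s : Set ℝ) (x : ℝ → ℝ) : Prop :=
  (∃ K : NNReal, LipschitzOnWith K x s) ∧
  ∀ᵐ t ∂(volume.restrict s), ∃ d, HasDerivAt x d t ∧
    normFlux A η (Up (x t) t) C ≤ d ∧ d ≤ normFlux A η (Um (x t) t) C

lemma hasDerivAt_of_smooth {f : ℝ → ℝ} (hf : ContDiff ℝ (⊤ : ℕ∞) f) (x : ℝ) :
    HasDerivAt f (deriv f x) x :=
  (hf.differentiable (by simp) x).hasDerivAt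

lemma contDiff_deriv_of_smooth {f : ℝ → ℝ} (hf : ContDiff ℝ (⊤ : ℕ∞) f) :
    ContDiff ℝ (⊤ : ℕ∞) (deriv f) :=
  (contDiff_infty_iff_deriv.1 hf).2

lemma continuous_deriv_of_smooth {f : ℝ → ℝ} (hf : ContDiff ℝ (⊤ : ℕ∞) f) :
    Continuous (deriv f) :=
  (contDiff_deriv_of_smooth hf).continuous

lemma strictMono_deriv_of_convex {f : ℝ → ℝ} (hf : ∀ x, 0 < deriv (deriv f) x) :
    StrictMono (deriv f) :=
  strictMono_of_deriv_pos hf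

lemma integral_deriv_of_smooth {f : ℝ → ℝ} (hf : ContDiff ℝ (⊤ : ℕ∞) f) (a b : ℝ) :
    ∫ w in a..b, deriv f w = f b - f a :=
  intervalIntegral.integral_deriv_eq_sub (fun x _ => (hasDerivAt_of_smooth hf x).differentiableAt)
    ((continuous_deriv_of_smooth hf).intervalIntegrable _ _)

lemma hasDerivAt_relEnt {η : ℝ → ℝ} (hη : ContDiff ℝ (⊤ : ℕ∞) η) (v C : ℝ) :
    HasDerivAt (fun v => relEnt η v C) (deriv η v - deriv η C) v := by
  unfold relEnt
  have h := (((hasDerivAt_of_smooth hη v).sub_const (η C)).sub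
    (((hasDerivAt_id v).sub_const C).const_mul (deriv η C)))
  exact h.congr_deriv (by simp)

lemma hasDerivAt_relFlux {A η : ℝ → ℝ} (hA : ContDiff ℝ (⊤ : ℕ∞) A)
    (hη : ContDiff ℝ (⊤ : ℕ∞) η) (v C : ℝ) :
    HasDerivAt (fun v => relFlux A η v C) ((deriv η v - deriv η C) * deriv A v) v := by
  unfold relFlux
  have hc : Continuous fun w => (deriv η w - deriv η C) * deriv A w :=
    ((continuous_deriv_of_smooth hη).sub continuous_const).mul (continuous_deriv_of_smooth hA)
  exact intervalIntegral.integral_hasDerivAt_right (hc.intervalIntegrable _ _)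
    (hc.stronglyMeasurableAtFilter _ _) hc.continuousAt

lemma contDiff_relEnt {η : ℝ → ℝ} (hη : ContDiff ℝ (⊤ : ℕ∞) η) (C : ℝ) :
    ContDiff ℝ (⊤ : ℕ∞) fun v => relEnt η v C := by
  unfold relEnt
  fun_prop

lemma contDiff_relFlux {A η : ℝ → ℝ} (hA : ContDiff ℝ (⊤ : ℕ∞) A)
    (hη : ContDiff ℝ (⊤ : ℕ∞) η) (C : ℝ) :
    ContDiff ℝ (⊤ : ℕ∞) fun v => relFlux A η v C := by
  refine contDiff_infty_iff_deriv.2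
    ⟨fun v => (hasDerivAt_relFlux hA hη v C).differentiableAt, ?_⟩
  rw [show deriv (fun v => relFlux A η v C) = fun v => (deriv η v - deriv η C) * deriv A v from
    funext fun v => (hasDerivAt_relFlux hA hη v C).deriv]
  exact ((contDiff_deriv_of_smooth hη).sub contDiff_const).mul (contDiff_deriv_of_smooth hA)

@[simp] lemma relEnt_self (η : ℝ → ℝ) (C : ℝ) : relEnt η C C = 0 := by simp [relEnt]

@[simp] lemma relFlux_self (A η : ℝ → ℝ) (C : ℝ) : relFlux A η C C = 0 := by simp [relFlux]

lemma exists_sub_eq_deriv_mul {f : ℝ → ℝ} (hf : ContDiff ℝ (⊤ : ℕ∞) f) {a b : ℝ} (hab : a ≠ b) :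
    ∃ c, (a < c ∧ c < b ∨ b < c ∧ c < a) ∧ f b - f a = deriv f c * (b - a) := by
  rcases lt_or_gt_of_ne hab with h | h
  · obtain ⟨c, hc, e⟩ := exists_deriv_eq_slope f h hf.continuous.continuousOn
      (hf.differentiable (by simp)).differentiableOn
    refine ⟨c, Or.inl hc, ?_⟩
    rw [e]; field_simp [sub_ne_zero.2 h.ne']
  · obtain ⟨c, hc, e⟩ := exists_deriv_eq_slope f h hf.continuous.continuousOn
      (hf.differentiable (by simp)).differentiableOn
    refine ⟨c, Or.inr hc, ?_⟩
    have : a - b ≠ 0 := sub_ne_zero.2 h.ne'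
    rw [e]; field_simp; ring

lemma relEnt_pos {η : ℝ → ℝ} (hη : ContDiff ℝ (⊤ : ℕ∞) η) (hconv : ∀ v, 0 < deriv (deriv η) v)
    {v C : ℝ} (h : v ≠ C) : 0 < relEnt η v C := by
  obtain ⟨c, hc, e⟩ := exists_sub_eq_deriv_mul hη h.symm
  have hm := strictMono_deriv_of_convex hconv
  unfold relEnt
  rw [e, ← sub_mul]
  rcases hc with hc | hc
  · exact mul_pos (sub_pos.2 (hm hc.1)) (by linarith)
  · exact mul_pos_of_neg_of_neg (sub_neg.2 (hm hc.2)) (by linarith)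

lemma relEnt_nonneg {η : ℝ → ℝ} (hη : ContDiff ℝ (⊤ : ℕ∞) η)
    (hconv : ∀ v, 0 < deriv (deriv η) v) (v C : ℝ) : 0 ≤ relEnt η v C := by
  rcases eq_or_ne v C with rfl | h
  · simp
  · exact (relEnt_pos hη hconv h).le

lemma relFlux_eq_normFlux_mul {A η : ℝ → ℝ} (hη : ContDiff ℝ (⊤ : ℕ∞) η)
    (hconv : ∀ v, 0 < deriv (deriv η) v) (v C : ℝ) :
    relFlux A η v C = normFlux A η v C * relEnt η v C := by
  unfold normFlux
  split_ifs with h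
  · simp [h]
  · rw [div_mul_cancel₀ _ (relEnt_pos hη hconv h).ne']

/-- The flux `F(v, C)` minus a multiple of the relative entropy, as a single integral. -/
lemma relFlux_sub_mul_relEnt {A η : ℝ → ℝ} (hA : ContDiff ℝ (⊤ : ℕ∞) A)
    (hη : ContDiff ℝ (⊤ : ℕ∞) η) (v C p : ℝ) :
    relFlux A η v C - p * relEnt η v C =
      ∫ w in C..v, (deriv η w - deriv η C) * (deriv A w - p) := by
  have hηc := continuous_deriv_of_smooth hη
  have hAc := continuous_deriv_of_smooth hA
  have h1 : relEnt η v C = ∫ w in C..v, (deriv η w - deriv η C) := by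
    rw [intervalIntegral.integral_sub (hηc.intervalIntegrable _ _)
      (continuous_const.intervalIntegrable _ _), integral_deriv_of_smooth hη]
    simp [relEnt]; ring
  rw [h1, relFlux, ← intervalIntegral.integral_const_mul, ← intervalIntegral.integral_sub]
  · congr 1; ext w; ring
  · exact ((hηc.sub continuous_const).mul hAc).intervalIntegrable _ _
  · exact (continuous_const.mul (hηc.sub continuous_const)).intervalIntegrable _ _

/-- Chebyshev inequality between the derivatives of the entropy and of the flux. -/
lemma chebyshev_relFlux {A η : ℝ → ℝ} (hA : ContDiff ℝ (⊤ : ℕ∞) A)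
    (hA'' : ∀ x, 0 < deriv (deriv A) x)
    (hη : ContDiff ℝ (⊤ : ℕ∞) η) (hconv : ∀ v, 0 < deriv (deriv η) v) (v C : ℝ) :
    0 ≤ (v - C) * relFlux A η v C - (A v - A C) * relEnt η v C := by
  rcases eq_or_ne C v with rfl | h
  · simp
  obtain ⟨c, -, e⟩ := exists_sub_eq_deriv_mul hA h
  have hηc := continuous_deriv_of_smooth hη
  have hAc := continuous_deriv_of_smooth hA
  have hηm := (strictMono_deriv_of_convex hconv).monotone
  have hAm := (strictMono_deriv_of_convex hA'').monotone
  have hpos : ∀ w, 0 ≤ (deriv η w - deriv η c) * (deriv A w - deriv A c) := by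
    intro w
    rcases le_total w c with hw | hw
    · exact mul_nonneg_of_nonpos_of_nonpos (sub_nonpos.2 (hηm hw)) (sub_nonpos.2 (hAm hw))
    · exact mul_nonneg (sub_nonneg.2 (hηm hw)) (sub_nonneg.2 (hAm hw))
  have key : relFlux A η v C - deriv A c * relEnt η v C =
      ∫ w in C..v, (deriv η w - deriv η c) * (deriv A w - deriv A c) := by
    have h0 : ∫ w in C..v, (deriv η c - deriv η C) * (deriv A w - deriv A c) = 0 := by
      rw [intervalIntegral.integral_const_mul, intervalIntegral.integral_sub
        (hAc.intervalIntegrable _ _) (continuous_const.intervalIntegrable _ _),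
        integral_deriv_of_smooth hA, e]
      simp; right; ring
    rw [relFlux_sub_mul_relEnt hA hη, ← sub_zero (∫ w in C..v, _), ← h0,
      ← intervalIntegral.integral_sub]
    · congr 1; ext w; ring
    · exact ((hηc.sub continuous_const).mul (hAc.sub continuous_const)).intervalIntegrable _ _
    · exact (continuous_const.mul (hAc.sub continuous_const)).intervalIntegrable _ _
  have : (v - C) * relFlux A η v C - (A v - A C) * relEnt η v C =
      (v - C) * (relFlux A η v C - deriv A c * relEnt η v C) := by rw [e]; ring
  rw [this, key]
  rcases le_total C v with hv | hv
  · exact mul_nonneg (sub_nonneg.2 hv) (intervalIntegral.integral_nonneg hv fun w _ => hpos w)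
  · rw [intervalIntegral.integral_symm]
    exact mul_nonneg_of_nonpos_of_nonpos (sub_nonpos.2 hv)
      (neg_nonpos.2 (intervalIntegral.integral_nonneg hv fun w _ => hpos w))

lemma normFlux_le_deriv {A η : ℝ → ℝ} (hA : ContDiff ℝ (⊤ : ℕ∞) A)
    (hA'' : ∀ x, 0 < deriv (deriv A) x)
    (hη : ContDiff ℝ (⊤ : ℕ∞) η) (hconv : ∀ v, 0 < deriv (deriv η) v) {v C : ℝ} (h : C ≤ v) :
    normFlux A η v C ≤ deriv A v := by
  rcases h.eq_or_lt with rfl | h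
  · simp [normFlux]
  have hηm := (strictMono_deriv_of_convex hconv).monotone
  have hAm := (strictMono_deriv_of_convex hA'').monotone
  rw [normFlux, if_neg h.ne', div_le_iff₀ (relEnt_pos hη hconv h.ne'), ← sub_nonpos,
    relFlux_sub_mul_relEnt hA hη, ← neg_nonneg, ← intervalIntegral.integral_neg]
  refine intervalIntegral.integral_nonneg h.le fun w hw => ?_
  rw [neg_nonneg]
  exact mul_nonpos_of_nonneg_of_nonpos (sub_nonneg.2 (hηm hw.1)) (sub_nonpos.2 (hAm hw.2))

lemma deriv_le_normFlux {A η : ℝ → ℝ} (hA : ContDiff ℝ (⊤ : ℕ∞) A)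
    (hA'' : ∀ x, 0 < deriv (deriv A) x)
    (hη : ContDiff ℝ (⊤ : ℕ∞) η) (hconv : ∀ v, 0 < deriv (deriv η) v) {v C : ℝ} (h : v ≤ C) :
    deriv A v ≤ normFlux A η v C := by
  rcases h.eq_or_lt with rfl | h
  · simp [normFlux]
  have hηm := (strictMono_deriv_of_convex hconv).monotone
  have hAm := (strictMono_deriv_of_convex hA'').monotone
  rw [normFlux, if_neg h.ne, le_div_iff₀ (relEnt_pos hη hconv h.ne), ← sub_nonneg,
    relFlux_sub_mul_relEnt hA hη, intervalIntegral.integral_symm, ← intervalIntegral.integral_neg]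
  refine intervalIntegral.integral_nonneg h.le fun w hw => ?_
  rw [neg_nonneg]
  exact mul_nonpos_of_nonpos_of_nonneg (sub_nonpos.2 (hηm hw.2)) (sub_nonneg.2 (hAm hw.1))

lemma relFlux_eq {A η : ℝ → ℝ} (hA : ContDiff ℝ (⊤ : ℕ∞) A)
    (hη : ContDiff ℝ (⊤ : ℕ∞) η) (v C : ℝ) :
    relFlux A η v C = (∫ w in C..v, deriv η w * deriv A w) - deriv η C * (A v - A C) := by
  have hηc := continuous_deriv_of_smooth hη
  have hAc := continuous_deriv_of_smooth hA
  rw [← integral_deriv_of_smooth hA, ← intervalIntegral.integral_const_mul,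
    ← intervalIntegral.integral_sub, relFlux]
  · congr 1; ext w; ring
  · exact (hηc.mul hAc).intervalIntegrable _ _
  · exact (continuous_const.mul hAc).intervalIntegrable _ _

lemma hasDerivAt_quotient_right {A η : ℝ → ℝ} (hA : ContDiff ℝ (⊤ : ℕ∞) A)
    (hη : ContDiff ℝ (⊤ : ℕ∞) η) (hconv : ∀ v, 0 < deriv (deriv η) v) {v C : ℝ} (h : v ≠ C) :
    HasDerivAt (fun C => relFlux A η v C / relEnt η v C)
      (deriv (deriv η) C *
        ((v - C) * relFlux A η v C - (A v - A C) * relEnt η v C) / relEnt η v C ^ 2) C := by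
  have hηc := continuous_deriv_of_smooth hη
  have hAc := continuous_deriv_of_smooth hA
  have hc : Continuous fun w => deriv η w * deriv A w := hηc.mul hAc
  have hη' := hasDerivAt_of_smooth (contDiff_deriv_of_smooth hη) C
  have hF : HasDerivAt (fun C => relFlux A η v C) (-(deriv (deriv η) C * (A v - A C))) C := by
    rw [show (fun C => relFlux A η v C) = fun C =>
      (∫ w in C..v, deriv η w * deriv A w) - deriv η C * (A v - A C) from
      funext fun C => relFlux_eq hA hη v C]
    have h1 := intervalIntegral.integral_hasDerivAt_left (hc.intervalIntegrable C v)
      (hc.stronglyMeasurableAtFilter _ _) hc.continuousAt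
    have h2 := hη'.mul ((hasDerivAt_of_smooth hA C).const_sub (A v))
    exact (h1.sub h2).congr_deriv (by ring)
  have hE : HasDerivAt (fun C => relEnt η v C) (-(deriv (deriv η) C * (v - C))) C := by
    unfold relEnt
    have h2 := hη'.mul ((hasDerivAt_id C).const_sub v)
    have h3 := ((hasDerivAt_of_smooth hη C).const_sub (η v)).sub h2
    exact h3.congr_deriv (by simp)
  exact (hF.div hE (relEnt_pos hη hconv h).ne').congr_deriv (by ring)

/-- The normalized relative entropy flux is nondecreasing in its second argument. -/
lemma normFlux_mono_right {A η : ℝ → ℝ} (hA : ContDiff ℝ (⊤ : ℕ∞) A)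
    (hA'' : ∀ x, 0 < deriv (deriv A) x)
    (hη : ContDiff ℝ (⊤ : ℕ∞) η) (hconv : ∀ v, 0 < deriv (deriv η) v) (v : ℝ) :
    Monotone (normFlux A η v) := by
  have aux : ∀ s : Set ℝ, Convex ℝ s → v ∉ s →
      MonotoneOn (fun C => relFlux A η v C / relEnt η v C) s := by
    intro s hs hv
    have hne : ∀ C ∈ s, v ≠ C := fun C hC e => hv (e ▸ hC)
    have hd := fun C (hC : C ∈ s) => hasDerivAt_quotient_right hA hη hconv (hne C hC)
    refine monotoneOn_of_deriv_nonneg hs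
      (fun C hC => (hd C hC).continuousAt.continuousWithinAt)
      (fun C hC => (hd C (interior_subset hC)).differentiableAt.differentiableWithinAt)
      fun C hC => ?_
    rw [(hd C (interior_subset hC)).deriv]
    exact div_nonneg (mul_nonneg (hconv C).le (chebyshev_relFlux hA hA'' hη hconv v C))
      (sq_nonneg _)
  intro C D hCD
  rcases le_or_gt v C with hC | hC
  · rcases hC.eq_or_lt with rfl | hC
    · simpa [normFlux] using deriv_le_normFlux hA hA'' hη hconv hCD
    · have := aux (Ioi v) (convex_Ioi v) (by simp) hC (hC.trans_le hCD) hCD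
      simpa [normFlux, hC.ne, (hC.trans_le hCD).ne] using this
  · rcases le_or_gt v D with hD | hD
    · exact (normFlux_le_deriv hA hA'' hη hconv hC.le).trans
        (deriv_le_normFlux hA hA'' hη hconv hD)
    · have := aux (Iio v) (convex_Iio v) (by simp) hC hD hCD
      simpa [normFlux, hC.ne', hD.ne'] using this

lemma integrable_of_bounded_of_support {f : ℝ → ℝ} (hm : Measurable f) {B R : ℝ}
    (hb : ∀ x, |f x| ≤ B) (hs : ∀ x, R < |x| → f x = 0) : Integrable f := by
  have hg : Integrable ((Icc (-R) R).indicator fun _ => B) :=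
    (integrableOn_const (by simp)).integrable_indicator measurableSet_Icc
  refine hg.mono' hm.aestronglyMeasurable (Eventually.of_forall fun x => ?_)
  by_cases hx : x ∈ Icc (-R) R
  · simpa [hx] using hb x
  · have : R < |x| := by
      by_contra! h
      exact hx (abs_le.1 h)
    simp [hx, hs x this]

lemma integral_tendsto_of_bounded_of_support {f : ℕ → ℝ → ℝ} {g : ℝ → ℝ}
    (hm : ∀ n, Measurable (f n)) {B R : ℝ}
    (hb : ∀ n x, |f n x| ≤ B) (hs : ∀ n x, R < |x| → f n x = 0)
    (hl : ∀ᵐ x, Tendsto (fun n => f n x) atTop (𝓝 (g x))) :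
    Tendsto (fun n => ∫ x, f n x) atTop (𝓝 (∫ x, g x)) := by
  refine tendsto_integral_of_dominated_convergence ((Icc (-R) R).indicator fun _ => B)
    (fun n => (hm n).aestronglyMeasurable)
    ((integrableOn_const (by simp)).integrable_indicator measurableSet_Icc)
    (fun n => Eventually.of_forall fun x => ?_) hl
  by_cases hx : x ∈ Icc (-R) R
  · simpa [hx] using hb n x
  · have : R < |x| := by
      by_contra! h
      exact hx (abs_le.1 h)
    simp [hx, hs n x this]

lemma abs_integral_le_of_bounded_of_support {f : ℝ → ℝ} {B R : ℝ} (hR : 0 ≤ R)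
    (hb : ∀ x, |f x| ≤ B) (hs : ∀ x, R < |x| → f x = 0) : |∫ x, f x| ≤ B * (2 * R) := by
  have h : ∫ x, f x = ∫ x in Icc (-R) R, f x := by
    refine (setIntegral_eq_integral_of_forall_compl_eq_zero fun x hx => hs x ?_).symm
    by_contra! h
    exact hx (abs_le.1 h)
  rw [h]
  have := norm_setIntegral_le_of_norm_le_const (s := Icc (-R) R) (μ := volume) (f := f) (C := B)
    (by simp) (fun x _ => hb x)
  rwa [Real.norm_eq_abs, Real.volume_real_Icc_of_le (by linarith),
    show R - -R = 2 * R by ring] at this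

/-- Dominated convergence for iterated integrals of uniformly bounded functions supported in a
fixed rectangle. -/
lemma tendsto_iterated_integral {f : ℕ → ℝ → ℝ → ℝ} {g : ℝ → ℝ → ℝ}
    (hm : ∀ n, Measurable fun p : ℝ × ℝ => f n p.1 p.2) {B R : ℝ} (hR : 0 ≤ R)
    (hb : ∀ n t x, 0 < t → |f n t x| ≤ B)
    (hs : ∀ n t x, 0 < t → (R < t ∨ R < |x|) → f n t x = 0)
    (hl : ∀ᵐ t, 0 < t → ∀ x, Tendsto (fun n => f n t x) atTop (𝓝 (g t x))) :
    Tendsto (fun n => ∫ t in Ioi (0 : ℝ), ∫ x, f n t x) atTop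
      (𝓝 (∫ t in Ioi (0 : ℝ), ∫ x, g t x)) := by
  simp only [← integral_indicator (measurableSet_Ioi (a := (0 : ℝ)))]
  refine integral_tendsto_of_bounded_of_support (B := B * (2 * R)) (R := R) (fun n => ?_)
    (fun n t => ?_) (fun n t ht => ?_) ?_
  · exact ((hm n).stronglyMeasurable.integral_prod_right.measurable).indicator measurableSet_Ioi
  · by_cases ht : t ∈ Ioi (0 : ℝ)
    · rw [indicator_of_mem ht]
      exact abs_integral_le_of_bounded_of_support hR (hb n t · ht)
        fun x hx => hs n t x ht (Or.inr hx)
    · rw [indicator_of_notMem ht, abs_zero]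
      have := (abs_nonneg _).trans (hb n 1 0 one_pos)
      positivity
  · by_cases ht0 : t ∈ Ioi (0 : ℝ)
    · rw [indicator_of_mem ht0]
      rw [abs_of_pos ht0] at ht
      simp [fun x => hs n t x ht0 (Or.inl ht)]
    · rw [indicator_of_notMem ht0]
  · filter_upwards [hl] with t ht
    by_cases ht0 : t ∈ Ioi (0 : ℝ)
    · simp only [indicator_of_mem ht0]
      exact integral_tendsto_of_bounded_of_support (fun n => (hm n).comp measurable_prodMk_left)
        (hb · t · ht0) (fun n x hx => hs n t x ht0 (Or.inr hx)) (Eventually.of_forall (ht ht0))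
    · simp only [indicator_of_notMem ht0]
      exact tendsto_const_nhds

/-- A Lipschitz function is a uniform limit of smooth functions with the same Lipschitz constant
whose derivatives converge almost everywhere. -/
lemma exists_smooth_approx {y : ℝ → ℝ} {K : NNReal} (hy : LipschitzWith K y) :
    ∃ u : ℕ → ℝ → ℝ, (∀ n, ContDiff ℝ (⊤ : ℕ∞) (u n)) ∧ (∀ n t, |deriv (u n) t| ≤ K) ∧
      (∀ n t, |u n t - y t| ≤ K / (n + 1)) ∧
      ∀ᵐ t, Tendsto (fun n => deriv (u n) t) atTop (𝓝 (deriv y t)) := by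
  let φ : ℕ → ContDiffBump (0 : ℝ) := fun n =>
    ⟨1 / (2 * (n + 1)), 1 / (n + 1), by positivity, by
      apply one_div_lt_one_div_of_lt <;> [positivity; linarith [Nat.cast_nonneg (α := ℝ) n]]⟩
  let L := ContinuousLinearMap.lsmul ℝ ℝ (E := ℝ)
  let u : ℕ → ℝ → ℝ := fun n => convolution ((φ n).normed volume) y L volume
  have hu : ∀ n t, u n t = ∫ s, (φ n).normed volume s * y (t - s) := fun n t => rfl
  have hcs : ∀ n, HasCompactSupport ((φ n).normed volume) := fun n => (φ n).hasCompactSupport_normed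
  have hφc : ∀ n, Continuous ((φ n).normed volume) := fun n => (φ n).continuous_normed
  have hint : ∀ n t, Integrable fun s => (φ n).normed volume s * y (t - s) := fun n t =>
    ((hφc n).mul (hy.continuous.comp (continuous_const.sub continuous_id)))
      |>.integrable_of_hasCompactSupport ((hcs n).mul_right)
  have hlip : ∀ n, LipschitzWith K (u n) := by
    intro n
    refine LipschitzWith.of_dist_le_mul fun a b => ?_
    rw [Real.dist_eq, hu, hu, ← integral_sub (hint n a) (hint n b)]
    have h1 : ∀ s, ‖(φ n).normed volume s * y (a - s) - (φ n).normed volume s * y (b - s)‖ ≤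
        (φ n).normed volume s * (K * dist a b) := by
      intro s
      rw [← mul_sub, norm_mul, Real.norm_of_nonneg ((φ n).nonneg_normed s)]
      refine mul_le_mul_of_nonneg_left ?_ ((φ n).nonneg_normed s)
      have := hy.dist_le_mul (a - s) (b - s)
      rwa [dist_sub_right] at this
    refine (norm_integral_le_of_norm_le ((φ n).integrable_normed.mul_const _)
      (Eventually.of_forall h1)).trans ?_
    rw [integral_mul_const, (φ n).integral_normed, one_mul]
  have hder : ∀ n t, deriv (u n) t = convolution ((φ n).normed volume) (deriv y) L volume t := by
    intro n t
    refine HasDerivAt.deriv (hasDerivAt_integral_of_dominated_loc_of_lip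
      (F := fun t s => (φ n).normed volume s * y (t - s))
      (F' := fun s => (φ n).normed volume s * deriv y (t - s))
      (bound := fun s => (φ n).normed volume s * K)
      (s := univ) univ_mem (Eventually.of_forall fun t => (hint n t).aestronglyMeasurable)
      (hint n t) ?_ ?_ ((φ n).integrable_normed.mul_const _) ?_).2
    · exact ((hφc n).measurable.mul ((measurable_deriv y).comp
        (measurable_const.sub measurable_id))).aestronglyMeasurable
    · refine Eventually.of_forall fun s => LipschitzOnWith.of_dist_le_mul fun a _ b _ => ?_
      have h0 : (0 : ℝ) ≤ (φ n).normed volume s * K :=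
        mul_nonneg ((φ n).nonneg_normed s) K.coe_nonneg
      rw [Real.coe_nnabs, abs_of_nonneg h0, Real.dist_eq, ← mul_sub, abs_mul,
        abs_of_nonneg ((φ n).nonneg_normed s), mul_assoc]
      refine mul_le_mul_of_nonneg_left ?_ ((φ n).nonneg_normed s)
      have := hy.dist_le_mul (a - s) (b - s)
      rwa [dist_sub_right, Real.dist_eq] at this
    · have hq : Measure.QuasiMeasurePreserving (fun s : ℝ => t - s) volume volume :=
        (Measure.measurePreserving_sub_left volume t).quasiMeasurePreserving
      filter_upwards [hq.ae hy.ae_differentiableAt_real] with s hs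
      have := (hs.hasDerivAt.comp_sub_const t s)
      exact this.const_mul _
  have hloc : LocallyIntegrable (deriv y) := by
    refine (locallyIntegrable_const (K : ℝ)).mono (measurable_deriv y).aestronglyMeasurable
      (Eventually.of_forall fun t => ?_)
    simpa using norm_deriv_le_of_lipschitz (x₀ := t) hy
  have hrout : Tendsto (fun n => (φ n).rOut) atTop (𝓝 0) :=
    tendsto_one_div_add_atTop_nhds_zero_nat
  refine ⟨u, fun n => ?_, fun n t => norm_deriv_le_of_lipschitz (hlip n), fun n t => ?_, ?_⟩
  · exact (hcs n).contDiff_convolution_left L (φ n).contDiff_normed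
      hy.continuous.locallyIntegrable
  · refine (φ n).dist_normed_convolution_le hy.continuous.aestronglyMeasurable fun s hs => ?_
    refine (hy.dist_le_mul s t).trans ?_
    rw [div_eq_mul_one_div]
    exact mul_le_mul_of_nonneg_left (Metric.mem_ball.1 hs).le K.coe_nonneg
  · have := ContDiffBump.ae_convolution_tendsto_right_of_locallyIntegrable (μ := volume)
      (φ := φ) (K := 2) hrout (Eventually.of_forall fun n => by
        simp only [φ]; apply le_of_eq; field_simp) hloc
    simpa only [hder] using this

lemma exists_smooth_step : ∃ H : ℝ → ℝ, ∃ B : ℝ, ContDiff ℝ (⊤ : ℕ∞) H ∧ (∀ s, 0 ≤ H s) ∧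
    (∀ s, H s ≤ 1) ∧ (∀ s ≤ 1, H s = 0) ∧ (∀ s, 2 ≤ s → H s = 1) ∧ (∀ s, 0 ≤ deriv H s) ∧
    (∀ s, 2 ≤ s → deriv H s = 0) ∧ ∀ s, |deriv H s| ≤ B := by
  let H : ℝ → ℝ := fun s => Real.smoothTransition (s - 1)
  have hsm : ContDiff ℝ (⊤ : ℕ∞) H :=
    Real.smoothTransition.contDiff.comp (contDiff_id.sub contDiff_const)
  have h0 : ∀ s ≤ 1, H s = 0 := fun s hs =>
    Real.smoothTransition.zero_of_nonpos (by linarith)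
  have h1 : ∀ s, 2 ≤ s → H s = 1 := fun s hs =>
    Real.smoothTransition.one_of_one_le (by linarith)
  have hn : ∀ s, 0 ≤ H s := fun s => Real.smoothTransition.nonneg _
  have hl : ∀ s, H s ≤ 1 := fun s => Real.smoothTransition.le_one _
  have hd2 : ∀ s, 2 ≤ s → deriv H s = 0 := fun s hs =>
    IsLocalMax.deriv_eq_zero (Eventually.of_forall fun r => (hl r).trans (h1 s hs).ge)
  have hd1 : ∀ s ≤ 1, deriv H s = 0 := fun s hs =>
    IsLocalMin.deriv_eq_zero (Eventually.of_forall fun r => (h0 s hs).le.trans (hn r))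
  have hcs : HasCompactSupport (deriv H) := by
    refine HasCompactSupport.intro (isCompact_Icc (a := (1 : ℝ)) (b := 2)) fun s hs => ?_
    rcases le_total s 1 with h | h
    · exact hd1 s h
    · exact hd2 s (by by_contra! h'; exact hs ⟨h, h'.le⟩)
  obtain ⟨B, hB⟩ := hcs.exists_bound_of_continuous (continuous_deriv_of_smooth hsm)
  refine ⟨H, B, hsm, hn, hl, h0, h1, fun s => ?_, hd2, hB⟩
  exact (Real.smoothTransition.monotone.comp fun a b hab => by simpa using hab).deriv_nonneg

/-- A smooth time cutoff, decreasing on `[0, T]` and vanishing afterwards. -/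
lemma exists_smooth_time_cutoff (T : ℝ) : ∃ β : ℝ → ℝ, ∃ b : ℝ, ContDiff ℝ (⊤ : ℕ∞) β ∧
    (∀ t, 0 ≤ β t) ∧ (∀ t, T ≤ t → β t = 0) ∧ (∀ t, T ≤ t → deriv β t = 0) ∧
    (∀ t, deriv β t ≤ 0) ∧ (∀ t < T, deriv β t < 0) ∧
    (∀ t, 0 ≤ t → |β t| ≤ b) ∧ ∀ t, 0 ≤ t → |deriv β t| ≤ b := by
  have hd : ∀ t, HasDerivAt (fun t => expNegInvGlue (T - t))
      (-((T - t)⁻¹ ^ 2 * expNegInvGlue (T - t))) t := by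
    intro t
    have h := expNegInvGlue.hasDerivAt_polynomial_eval_inv_mul 1 (T - t)
    simp only [Polynomial.eval_one, one_mul, Polynomial.derivative_one, sub_zero, mul_one,
      Polynomial.eval_pow, Polynomial.eval_X] at h
    exact h.comp_const_sub T t
  have hsm : ContDiff ℝ (⊤ : ℕ∞) fun t => expNegInvGlue (T - t) :=
    expNegInvGlue.contDiff.comp (by fun_prop)
  have hz : ∀ t, T ≤ t → expNegInvGlue (T - t) = 0 := fun t ht =>
    expNegInvGlue.zero_of_nonpos (by linarith)
  have hdz : ∀ t, T ≤ t → deriv (fun t => expNegInvGlue (T - t)) t = 0 := fun t ht => by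
    rw [(hd t).deriv, hz t ht]; simp
  obtain ⟨b₁, hb₁⟩ := (isCompact_Icc (a := (0 : ℝ)) (b := T)).exists_bound_of_continuousOn
    hsm.continuous.continuousOn
  obtain ⟨b₂, hb₂⟩ := (isCompact_Icc (a := (0 : ℝ)) (b := T)).exists_bound_of_continuousOn
    (continuous_deriv_of_smooth hsm).continuousOn
  refine ⟨fun t => expNegInvGlue (T - t), max (max b₁ b₂) 0, hsm,
    fun t => expNegInvGlue.nonneg _, hz, hdz, fun t => ?_, fun t ht => ?_, fun t ht => ?_,
    fun t ht => ?_⟩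
  · rw [(hd t).deriv, neg_nonpos]
    exact mul_nonneg (sq_nonneg _) (expNegInvGlue.nonneg _)
  · rw [(hd t).deriv, neg_neg_iff_pos]
    have : 0 < T - t := by linarith
    exact mul_pos (by positivity) (expNegInvGlue.pos_of_pos this)
  · rcases le_total T t with h | h
    · simp [hz t h]
    · exact (hb₁ t ⟨ht, h⟩).trans ((le_max_left _ _).trans (le_max_left _ _))
  · rcases le_total T t with h | h
    · simp [hdz t h]
    · exact (hb₂ t ⟨ht, h⟩).trans ((le_max_right _ _).trans (le_max_left _ _))

/-- The integrand of the entropy inequality for the test function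
`β(t) h(x - a(t)) h(b(t) - x)`, where `p = a'(t)` and `q = b'(t)`. -/
def curveIntegrand (Φ G : ℝ → ℝ) (U : ℝ → ℝ → ℝ) (β h : ℝ → ℝ) (a b p q t x : ℝ) : ℝ :=
  Φ (U x t) * deriv β t * (h (x - a) * h (b - x)) +
    β t * (deriv h (x - a) * h (b - x) * (G (U x t) - p * Φ (U x t)) -
      h (x - a) * deriv h (b - x) * (G (U x t) - q * Φ (U x t)))

lemma measurable_curveIntegrand {A Φ G β h : ℝ → ℝ} {U : ℝ → ℝ → ℝ} (hsol : IsEntropySol A U)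
    (hΦ : Continuous Φ) (hG : Continuous G) (hβ : Continuous β) (hh : Continuous h)
    {a b p q : ℝ → ℝ} (ha : Measurable a) (hb : Measurable b) (hp : Measurable p)
    (hq : Measurable q) :
    Measurable fun r : ℝ × ℝ => curveIntegrand Φ G U β h (a r.1) (b r.1) (p r.1) (q r.1) r.1 r.2 := by
  have hU : Measurable fun r : ℝ × ℝ => U r.2 r.1 := hsol.measurable.comp measurable_swap
  have hΦU := hΦ.measurable.comp hU
  have hGU := hG.measurable.comp hU
  have hh := hh.measurable
  have hβ := hβ.measurable
  have hh' := measurable_deriv h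
  have hβ' := measurable_deriv β
  have e₁ : Measurable fun r : ℝ × ℝ => r.2 - a r.1 := by fun_prop
  have e₂ : Measurable fun r : ℝ × ℝ => b r.1 - r.2 := by fun_prop
  have hp' : Measurable fun r : ℝ × ℝ => p r.1 := hp.comp measurable_fst
  have hq' : Measurable fun r : ℝ × ℝ => q r.1 := hq.comp measurable_fst
  exact ((hΦU.mul (hβ'.comp measurable_fst)).mul ((hh.comp e₁).mul (hh.comp e₂))).add
    ((hβ.comp measurable_fst).mul
      ((((hh'.comp e₁).mul (hh.comp e₂)).mul (hGU.sub (hp'.mul hΦU))).sub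
        (((hh.comp e₁).mul (hh'.comp e₂)).mul (hGU.sub (hq'.mul hΦU)))))

lemma abs_curveIntegrand_le {Φ G β h : ℝ → ℝ} {U : ℝ → ℝ → ℝ} {P B c K : ℝ}
    (hΦP : ∀ x t, |Φ (U x t)| ≤ P) (hGP : ∀ x t, |G (U x t)| ≤ P)
    (h0 : ∀ s, 0 ≤ h s) (h1 : ∀ s, h s ≤ 1) (hB : ∀ s, |deriv h s| ≤ B)
    {a b p q t x : ℝ} (hp : |p| ≤ K) (hq : |q| ≤ K) (hβ : |β t| ≤ c) (hβ' : |deriv β t| ≤ c) :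
    |curveIntegrand Φ G U β h a b p q t x| ≤
      P * c * (1 * 1) + c * (B * 1 * (P + K * P) + 1 * B * (P + K * P)) := by
  have hP : 0 ≤ P := (abs_nonneg _).trans (hΦP x t)
  have hc : 0 ≤ c := (abs_nonneg _).trans hβ
  have hB0 : 0 ≤ B := (abs_nonneg _).trans (hB 0)
  have hK : 0 ≤ K := (abs_nonneg _).trans hp
  have hh : ∀ s, |h s| ≤ 1 := fun s => by rw [abs_of_nonneg (h0 s)]; exact h1 s
  have hfl : ∀ r, |r| ≤ K → |G (U x t) - r * Φ (U x t)| ≤ P + K * P := by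
    intro r hr
    refine (abs_sub _ _).trans (add_le_add (hGP x t) ?_)
    rw [abs_mul]
    exact mul_le_mul hr (hΦP x t) (abs_nonneg _) hK
  unfold curveIntegrand
  refine (abs_add_le _ _).trans (add_le_add ?_ ?_)
  · rw [abs_mul, abs_mul, abs_mul]
    gcongr
    exacts [hΦP x t, hh _, hh _]
  · rw [abs_mul]
    refine mul_le_mul hβ ((abs_sub _ _).trans (add_le_add ?_ ?_)) (abs_nonneg _) hc
    · rw [abs_mul, abs_mul]
      gcongr
      exacts [hB _, hh _, hfl p hp]
    · rw [abs_mul, abs_mul]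
      gcongr
      exacts [hh _, hB _, hfl q hq]

lemma deriv_eq_zero_of_nonneg_of_eq_zero {h : ℝ → ℝ} (h0 : ∀ s, 0 ≤ h s) {s : ℝ} (hs : h s = 0) :
    deriv h s = 0 :=
  IsLocalMin.deriv_eq_zero (Eventually.of_forall fun r => hs.le.trans (h0 r))

lemma curveIntegrand_eq_zero {Φ G β h : ℝ → ℝ} {U : ℝ → ℝ → ℝ} (h0 : ∀ s, 0 ≤ h s)
    {a b p q t x : ℝ}
    (H : (β t = 0 ∧ deriv β t = 0) ∨ h (x - a) = 0 ∨ h (b - x) = 0) :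
    curveIntegrand Φ G U β h a b p q t x = 0 := by
  unfold curveIntegrand
  rcases H with ⟨h₁, h₂⟩ | H | H
  · simp [h₁, h₂]
  · simp [H, deriv_eq_zero_of_nonneg_of_eq_zero h0 H]
  · simp [H, deriv_eq_zero_of_nonneg_of_eq_zero h0 H]

lemma tendsto_curveIntegrand {Φ G β h : ℝ → ℝ} {U : ℝ → ℝ → ℝ} (hh : ContDiff ℝ (⊤ : ℕ∞) h)
    {a b p q : ℕ → ℝ} {a' b' p' q' : ℝ} (t x : ℝ) (ha : Tendsto a atTop (𝓝 a'))
    (hb : Tendsto b atTop (𝓝 b')) (hp : Tendsto p atTop (𝓝 p')) (hq : Tendsto q atTop (𝓝 q')) :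
    Tendsto (fun n => curveIntegrand Φ G U β h (a n) (b n) (p n) (q n) t x) atTop
      (𝓝 (curveIntegrand Φ G U β h a' b' p' q' t x)) := by
  have hc := hh.continuous
  have hc' := continuous_deriv_of_smooth hh
  have : Continuous fun r : ℝ × ℝ × ℝ × ℝ =>
      curveIntegrand Φ G U β h r.1 r.2.1 r.2.2.1 r.2.2.2 t x := by
    unfold curveIntegrand
    fun_prop
  exact (this.tendsto (a', b', p', q')).comp
    (ha.prodMk_nhds (hb.prodMk_nhds (hp.prodMk_nhds hq)))

/-- The entropy inequality tested against `β(t) h(x - y(t)) h(z(t) - x)` with smooth curves. -/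
lemma entropy_along_smooth_curves {A Φ G : ℝ → ℝ} {U : ℝ → ℝ → ℝ} (hsol : IsEntropySol A U)
    (hΦ : ContDiff ℝ (⊤ : ℕ∞) Φ) (hG : ContDiff ℝ (⊤ : ℕ∞) G)
    (hconv : ∀ v, 0 ≤ deriv (deriv Φ) v) (hflux : ∀ v, deriv G v = deriv Φ v * deriv A v)
    {u v β h : ℝ → ℝ} (hu : ContDiff ℝ (⊤ : ℕ∞) u) (hv : ContDiff ℝ (⊤ : ℕ∞) v)
    (hβ : ContDiff ℝ (⊤ : ℕ∞) β) (hh : ContDiff ℝ (⊤ : ℕ∞) h)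
    (h0 : ∀ s, 0 ≤ h s) (hβ0 : ∀ t, 0 ≤ β t) {R : ℝ}
    (hneg : ∀ x t, t ≤ 0 → h (x - u t) * h (v t - x) = 0)
    (hsupp : ∀ x t, 0 < t → (R < t ∨ R < |x|) → β t * (h (x - u t) * h (v t - x)) = 0) :
    0 ≤ ∫ t in Ioi (0 : ℝ), ∫ x,
      curveIntegrand Φ G U β h (u t) (v t) (deriv u t) (deriv v t) t x := by
  have key := hsol.entropy Φ G hΦ hG hconv hflux
    (fun x t => β t * (h (x - u t) * h (v t - x))) ?_ ?_ ?_ ?_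
  · convert key using 6 with t x
    have e₁ : HasDerivAt (fun s => h (x - u s)) (deriv h (x - u t) * -deriv u t) t :=
      (hasDerivAt_of_smooth hh _).comp t ((hasDerivAt_of_smooth hu t).const_sub x)
    have e₂ : HasDerivAt (fun s => h (v s - x)) (deriv h (v t - x) * deriv v t) t :=
      (hasDerivAt_of_smooth hh _).comp t ((hasDerivAt_of_smooth hv t).sub_const x)
    have e₃ : HasDerivAt (fun r => h (r - u t)) (deriv h (x - u t)) x := by
      simpa using (hasDerivAt_of_smooth hh (x - u t)).comp_sub_const x (u t)
    have e₄ : HasDerivAt (fun r => h (v t - r)) (-deriv h (v t - x)) x :=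
      (hasDerivAt_of_smooth hh (v t - x)).comp_const_sub (v t) x
    have d₁ := ((hasDerivAt_of_smooth hβ t).mul (e₁.mul e₂)).deriv
    have d₂ := ((e₃.mul e₄).const_mul (β t)).deriv
    have d₁' : deriv (fun s => β s * (h (x - u s) * h (v s - x))) t = _ := d₁
    have d₂' : deriv (fun r => β t * (h (r - u t) * h (v t - r))) x = _ := d₂
    rw [d₁', d₂', curveIntegrand]
    simp only [Pi.mul_apply]
    ring
  · exact (hβ.comp contDiff_snd).mul
      ((hh.comp (contDiff_fst.sub (hu.comp contDiff_snd))).mul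
        (hh.comp ((hv.comp contDiff_snd).sub contDiff_fst)))
  · refine HasCompactSupport.intro
      ((isCompact_Icc (a := -R) (b := R)).prod (isCompact_Icc (a := (0 : ℝ)) (b := R))) ?_
    rintro ⟨x, t⟩ hxt
    rcases le_or_gt t 0 with ht | ht
    · simp [hneg x t ht]
    · refine hsupp x t ht ?_
      by_contra! H
      exact hxt ⟨abs_le.1 H.2, ht.le, H.1⟩
  · exact fun x t => mul_nonneg (hβ0 t) (mul_nonneg (h0 _) (h0 _))
  · exact fun x t ht => by simp [hneg x t ht]

/-- The entropy inequality tested against `β(t) h(x - y(t)) h(z(t) - x)` with Lipschitz curves. -/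
lemma entropy_along_lipschitz_curves {A Φ G : ℝ → ℝ} {U : ℝ → ℝ → ℝ} (hsol : IsEntropySol A U)
    (hΦ : ContDiff ℝ (⊤ : ℕ∞) Φ) (hG : ContDiff ℝ (⊤ : ℕ∞) G)
    (hconv : ∀ v, 0 ≤ deriv (deriv Φ) v) (hflux : ∀ v, deriv G v = deriv Φ v * deriv A v)
    {P : ℝ} (hΦP : ∀ x t, |Φ (U x t)| ≤ P) (hGP : ∀ x t, |G (U x t)| ≤ P)
    {y z β h : ℝ → ℝ} {K : NNReal} (hy : LipschitzWith K y) (hz : LipschitzWith K z)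
    (hy0 : ∀ t ≤ 0, y t = 0) (hz0 : ∀ t ≤ 0, z t = 0)
    (hh : ContDiff ℝ (⊤ : ℕ∞) h) (h0 : ∀ s, 0 ≤ h s) (h1 : ∀ s, h s ≤ 1) {c B : ℝ} (hc : 0 < c)
    (hhc : ∀ s ≤ c, h s = 0) (hB : ∀ s, |deriv h s| ≤ B)
    (hβ : ContDiff ℝ (⊤ : ℕ∞) β) (hβ0 : ∀ t, 0 ≤ β t) {T b : ℝ} (hT : 0 ≤ T)
    (hβT : ∀ t, T ≤ t → β t = 0) (hβT' : ∀ t, T ≤ t → deriv β t = 0)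
    (hβb : ∀ t, 0 ≤ t → |β t| ≤ b) (hβb' : ∀ t, 0 ≤ t → |deriv β t| ≤ b) :
    0 ≤ ∫ t in Ioi (0 : ℝ), ∫ x,
      curveIntegrand Φ G U β h (y t) (z t) (deriv y t) (deriv z t) t x := by
  obtain ⟨u, hu, hud, huy, hul⟩ := exists_smooth_approx hy
  obtain ⟨v, hv, hvd, hvz, hvl⟩ := exists_smooth_approx hz
  have hK : (0 : ℝ) ≤ K := K.coe_nonneg
  let R : ℝ := K * T + K + T
  have hbound : ∀ (w : ℕ → ℝ → ℝ) (x : ℝ → ℝ), LipschitzWith K x → x 0 = 0 →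
      (∀ n t, |w n t - x t| ≤ K / (n + 1)) → ∀ n t, 0 < t → t ≤ T → |w n t| ≤ R := by
    intro w x hx hx0 hw n t ht htT
    have h₁ : |x t| ≤ K * t := by
      simpa [hx0, abs_of_pos ht] using hx.dist_le_mul t 0
    have h₂ : (K : ℝ) / (n + 1) ≤ K :=
      div_le_self hK (by linarith [Nat.cast_nonneg (α := ℝ) n])
    have h₃ : |w n t| ≤ |w n t - x t| + |x t| := by
      simpa using abs_add_le (w n t - x t) (x t)
    have h₄ : K * t ≤ K * T := mul_le_mul_of_nonneg_left htT hK
    have := hw n t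
    simp only [R]
    linarith
  have hzero : ∀ n t x, 0 < t → (R < t ∨ R < |x|) →
      (β t = 0 ∧ deriv β t = 0) ∨ h (x - u n t) = 0 ∨ h (v n t - x) = 0 := by
    intro n t x ht H
    rcases le_or_gt T t with hTt | hTt
    · exact Or.inl ⟨hβT t hTt, hβT' t hTt⟩
    · refine Or.inr ?_
      have hu' := abs_le.1 (hbound u y hy (hy0 0 le_rfl) huy n t ht hTt.le)
      have hv' := abs_le.1 (hbound v z hz (hz0 0 le_rfl) hvz n t ht hTt.le)
      rcases H with H | H
      · have : 0 ≤ K * T := by positivity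
        simp only [R] at H
        linarith
      · rcases lt_abs.1 H with H | H
        · exact Or.inr (hhc _ (by linarith))
        · exact Or.inl (hhc _ (by linarith))
  have hlim := tendsto_iterated_integral
    (f := fun n t x => curveIntegrand Φ G U β h (u n t) (v n t) (deriv (u n) t) (deriv (v n) t) t x)
    (g := fun t x => curveIntegrand Φ G U β h (y t) (z t) (deriv y t) (deriv z t) t x)
    (B := P * b * (1 * 1) + b * (B * 1 * (P + K * P) + 1 * B * (P + K * P))) (R := R)
    (fun n => measurable_curveIntegrand hsol hΦ.continuous hG.continuous hβ.continuous
      hh.continuous (hu n).continuous.measurable (hv n).continuous.measurable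
      (measurable_deriv _) (measurable_deriv _))
    (by positivity)
    (fun n t x ht => abs_curveIntegrand_le hΦP hGP h0 h1 hB (hud n t) (hvd n t)
      (hβb t ht.le) (hβb' t ht.le))
    (fun n t x ht H => curveIntegrand_eq_zero h0 (hzero n t x ht H))
    (by
      filter_upwards [hul, hvl] with t htu htv _ x
      have hKn : Tendsto (fun n : ℕ => (K : ℝ) / (n + 1)) atTop (𝓝 0) := by
        simpa [div_eq_mul_inv] using tendsto_one_div_add_atTop_nhds_zero_nat.const_mul (K : ℝ)
      have hpt : ∀ (w : ℕ → ℝ → ℝ) (x : ℝ → ℝ), (∀ n t, |w n t - x t| ≤ K / (n + 1)) →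
          Tendsto (fun n => w n t) atTop (𝓝 (x t)) := fun w x hw =>
        tendsto_iff_dist_tendsto_zero.2 (squeeze_zero (fun n => dist_nonneg) (hw · t) hKn)
      exact tendsto_curveIntegrand hh t x (hpt u y huy) (hpt v z hvz) htu htv)
  refine ge_of_tendsto hlim ?_
  have hKn : Tendsto (fun n : ℕ => (K : ℝ) / (n + 1)) atTop (𝓝 0) := by
    simpa [div_eq_mul_inv] using tendsto_one_div_add_atTop_nhds_zero_nat.const_mul (K : ℝ)
  filter_upwards [hKn.eventually (gt_mem_nhds hc)] with n hn
  refine entropy_along_smooth_curves hsol hΦ hG hconv hflux (hu n) (hv n) hβ hh h0 hβ0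
    (R := R) (fun x t ht => ?_) fun x t ht H => ?_
  · have h₁ := abs_le.1 (huy n t)
    have h₂ := abs_le.1 (hvz n t)
    rw [hy0 t ht] at h₁
    rw [hz0 t ht] at h₂
    rcases le_total x 0 with hx | hx
    · rw [hhc (x - u n t) (by linarith), zero_mul]
    · rw [hhc (v n t - x) (by linarith), mul_zero]
  · rcases hzero n t x ht H with H | H | H <;> simp [H]

lemma integrableOn_iterated_integral {f : ℝ → ℝ → ℝ}
    (hm : Measurable fun p : ℝ × ℝ => f p.1 p.2) {B R : ℝ} (hR : 0 ≤ R)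
    (hb : ∀ t x, 0 < t → |f t x| ≤ B)
    (hs : ∀ t x, 0 < t → (R < t ∨ R < |x|) → f t x = 0) :
    IntegrableOn (fun t => ∫ x, f t x) (Ioi 0) := by
  rw [← integrable_indicator_iff measurableSet_Ioi]
  refine integrable_of_bounded_of_support (B := B * (2 * R)) (R := R)
    (hm.stronglyMeasurable.integral_prod_right.measurable.indicator measurableSet_Ioi)
    (fun t => ?_) fun t ht => ?_
  · by_cases ht : t ∈ Ioi (0 : ℝ)
    · rw [indicator_of_mem ht]
      exact abs_integral_le_of_bounded_of_support hR (hb t · ht) fun x hx => hs t x ht (Or.inr hx)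
    · rw [indicator_of_notMem ht, abs_zero]
      have := (abs_nonneg _).trans (hb 1 0 one_pos)
      positivity
  · by_cases ht0 : t ∈ Ioi (0 : ℝ)
    · rw [indicator_of_mem ht0]
      rw [abs_of_pos ht0] at ht
      simp [fun x => hs t x ht0 (Or.inl ht)]
    · rw [indicator_of_notMem ht0]

lemma integral_rescale_right (k : ℝ → ℝ) {N : ℝ} (hN : 0 < N) (a : ℝ) :
    ∫ x, N * k (N * (x - a)) = ∫ s, k s := by
  rw [integral_const_mul, integral_sub_right_eq_self (fun x => k (N * x)) a,
    Measure.integral_comp_mul_left, abs_of_pos (inv_pos.2 hN), smul_eq_mul,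
    mul_inv_cancel_left₀ hN.ne']

lemma integral_rescale_left (k : ℝ → ℝ) {N : ℝ} (hN : 0 < N) (b : ℝ) :
    ∫ x, N * k (N * (b - x)) = ∫ s, k s := by
  rw [integral_const_mul, integral_sub_left_eq_self (fun x => k (N * x)) volume b,
    Measure.integral_comp_mul_left, abs_of_pos (inv_pos.2 hN), smul_eq_mul,
    mul_inv_cancel_left₀ hN.ne']

/-- An upper bound for `curveIntegrand` with the profile `s ↦ H(N s)`, after rescaling the
boundary layers at `a` and `b` to unit size. -/
def layerIntegrand (κ : ℝ) (Φ G : ℝ → ℝ) (U : ℝ → ℝ → ℝ) (β H : ℝ → ℝ)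
    (N a b p q t x : ℝ) : ℝ :=
  κ * deriv β t * (H (N * (x - a)) * H (N * (b - x))) +
    (β t * deriv H x * max (G (U (a + x / N) t) - p * Φ (U (a + x / N) t)) 0 +
      β t * deriv H x * max (q * Φ (U (b - x / N) t) - G (U (b - x / N) t)) 0)

lemma measurable_layerIntegrand {A Φ G β H : ℝ → ℝ} {U : ℝ → ℝ → ℝ} (hsol : IsEntropySol A U)
    (hΦ : Continuous Φ) (hG : Continuous G) (hβ : Continuous β) (hH : Continuous H)
    {a b p q : ℝ → ℝ} (ha : Measurable a) (hb : Measurable b) (hp : Measurable p)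
    (hq : Measurable q) (κ N : ℝ) :
    Measurable fun r : ℝ × ℝ =>
      layerIntegrand κ Φ G U β H N (a r.1) (b r.1) (p r.1) (q r.1) r.1 r.2 := by
  have l₁ : Measurable fun r : ℝ × ℝ => (a r.1 + r.2 / N, r.1) := by fun_prop
  have l₂ : Measurable fun r : ℝ × ℝ => (b r.1 - r.2 / N, r.1) := by fun_prop
  have u₁ := hsol.measurable.comp l₁
  have u₂ := hsol.measurable.comp l₂
  have e₁ : Measurable fun r : ℝ × ℝ => N * (r.2 - a r.1) := by fun_prop
  have e₂ : Measurable fun r : ℝ × ℝ => N * (b r.1 - r.2) := by fun_prop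
  have hp' : Measurable fun r : ℝ × ℝ => p r.1 := hp.comp measurable_fst
  have hq' : Measurable fun r : ℝ × ℝ => q r.1 := hq.comp measurable_fst
  have hΦ := hΦ.measurable
  have hG := hG.measurable
  have hH' : Measurable fun r : ℝ × ℝ => deriv H r.2 := (measurable_deriv H).comp measurable_snd
  have hβ' : Measurable fun r : ℝ × ℝ => deriv β r.1 := (measurable_deriv β).comp measurable_fst
  have hβ : Measurable fun r : ℝ × ℝ => β r.1 := hβ.measurable.comp measurable_fst
  have hH := hH.measurable
  exact ((hβ'.const_mul κ).mul ((hH.comp e₁).mul (hH.comp e₂))).add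
    (((hβ.mul hH').mul (((hG.comp u₁).sub (hp'.mul (hΦ.comp u₁))).max measurable_const)).add
      ((hβ.mul hH').mul (((hq'.mul (hΦ.comp u₂)).sub (hG.comp u₂)).max measurable_const)))

lemma abs_max_zero_le {r c : ℝ} (h : |r| ≤ c) : |max r 0| ≤ c := by
  rw [abs_of_nonneg (le_max_right _ _)]
  exact max_le ((le_abs_self r).trans h) ((abs_nonneg r).trans h)

lemma abs_sub_mul_le {f g r P K : ℝ} (hf : |f| ≤ P) (hg : |g| ≤ P) (hr : |r| ≤ K) :
    |f - r * g| ≤ P + K * P := by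
  refine (abs_sub _ _).trans (add_le_add hf ?_)
  rw [abs_mul]
  exact mul_le_mul hr hg (abs_nonneg _) ((abs_nonneg _).trans hr)

lemma abs_layerIntegrand_le {Φ G β H : ℝ → ℝ} {U : ℝ → ℝ → ℝ} {P B c K κ : ℝ} (hκ : 0 ≤ κ)
    (hΦP : ∀ x t, |Φ (U x t)| ≤ P) (hGP : ∀ x t, |G (U x t)| ≤ P)
    (h0 : ∀ s, 0 ≤ H s) (h1 : ∀ s, H s ≤ 1) (hB : ∀ s, |deriv H s| ≤ B)
    {N a b p q t x : ℝ} (hp : |p| ≤ K) (hq : |q| ≤ K) (hβ : |β t| ≤ c) (hβ' : |deriv β t| ≤ c) :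
    |layerIntegrand κ Φ G U β H N a b p q t x| ≤
      κ * c * (1 * 1) + (c * B * (P + K * P) + c * B * (P + K * P)) := by
  have hc : 0 ≤ c := (abs_nonneg _).trans hβ
  have hB0 : 0 ≤ B := (abs_nonneg _).trans (hB 0)
  have hh : ∀ s, |H s| ≤ 1 := fun s => by rw [abs_of_nonneg (h0 s)]; exact h1 s
  unfold layerIntegrand
  refine (abs_add_le _ _).trans (add_le_add ?_ ((abs_add_le _ _).trans (add_le_add ?_ ?_)))
  · rw [abs_mul, abs_mul, abs_mul, abs_of_nonneg hκ]
    gcongr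
    exacts [hh _, hh _]
  · rw [abs_mul, abs_mul]
    gcongr
    exacts [hB _, abs_max_zero_le (abs_sub_mul_le (hGP _ _) (hΦP _ _) hp)]
  · rw [abs_mul, abs_mul]
    gcongr
    exacts [hB _, abs_max_zero_le (by rw [abs_sub_comm]; exact abs_sub_mul_le (hGP _ _) (hΦP _ _) hq)]

lemma layerIntegrand_eq_zero {κ : ℝ} {Φ G β H : ℝ → ℝ} {U : ℝ → ℝ → ℝ} {N a b p q t x : ℝ}
    (h : (β t = 0 ∧ deriv β t = 0) ∨
      ((H (N * (x - a)) = 0 ∨ H (N * (b - x)) = 0) ∧ deriv H x = 0)) :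
    layerIntegrand κ Φ G U β H N a b p q t x = 0 := by
  unfold layerIntegrand
  rcases h with ⟨h₁, h₂⟩ | ⟨h₁ | h₁, h₂⟩ <;> simp [h₁, h₂]

lemma integral_curveIntegrand_le {A Φ G β H : ℝ → ℝ} {U : ℝ → ℝ → ℝ} (hsol : IsEntropySol A U)
    (hΦ : Continuous Φ) (hG : Continuous G) (hβ : Continuous β) (hH : ContDiff ℝ (⊤ : ℕ∞) H)
    {P B K κ : ℝ} (hκ : 0 ≤ κ) (hΦκ : ∀ x t, κ ≤ Φ (U x t))
    (hΦP : ∀ x t, |Φ (U x t)| ≤ P) (hGP : ∀ x t, |G (U x t)| ≤ P)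
    (h0 : ∀ s, 0 ≤ H s) (h1 : ∀ s, H s ≤ 1) (hH1 : ∀ s ≤ 1, H s = 0)
    (hd : ∀ s, 0 ≤ deriv H s) (hd2 : ∀ s, 2 ≤ s → deriv H s = 0) (hB : ∀ s, |deriv H s| ≤ B)
    {N : ℝ} (hN : 0 < N) {a b p q t : ℝ} (hp : |p| ≤ K) (hq : |q| ≤ K) (hβ0 : 0 ≤ β t)
    (hβ' : deriv β t ≤ 0) :
    ∫ x, curveIntegrand Φ G U β (fun s => H (N * s)) a b p q t x ≤
      ∫ x, layerIntegrand κ Φ G U β H N a b p q t x := by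
  have hHs : ContDiff ℝ (⊤ : ℕ∞) fun s => H (N * s) := hH.comp (contDiff_const.mul contDiff_id)
  have hder : ∀ s, deriv (fun s => H (N * s)) s = N * deriv H (N * s) := fun s => by
    have := deriv_comp_mul_left N H s
    simpa using this
  have hd1 : ∀ s ≤ 1, deriv H s = 0 := fun s hs =>
    deriv_eq_zero_of_nonneg_of_eq_zero h0 (hH1 s hs)
  have hU : Measurable fun x => U x t := hsol.measurable.comp measurable_prodMk_right
  have hHm := hH.continuous.measurable
  have hH' := measurable_deriv H
  have hΦU : ∀ {l : ℝ → ℝ}, Measurable l → Measurable fun x => Φ (U (l x) t) := fun hl =>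
    hΦ.measurable.comp (hU.comp hl)
  have hGU : ∀ {l : ℝ → ℝ}, Measurable l → Measurable fun x => G (U (l x) t) := fun hl =>
    hG.measurable.comp (hU.comp hl)
  set k₀ : ℝ → ℝ := fun x => κ * deriv β t * (H (N * (x - a)) * H (N * (b - x))) with hk₀
  set k₁ : ℝ → ℝ := fun x =>
    β t * deriv H x * max (G (U (a + x / N) t) - p * Φ (U (a + x / N) t)) 0 with hk₁
  set k₂ : ℝ → ℝ := fun x =>
    β t * deriv H x * max (q * Φ (U (b - x / N) t) - G (U (b - x / N) t)) 0 with hk₂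
  have hB0 : 0 ≤ B := (abs_nonneg _).trans (hB 0)
  have i₀ : Integrable k₀ := by
    refine integrable_of_bounded_of_support (B := κ * |deriv β t| * (1 * 1)) (R := |a| + |b|)
      ?_ (fun x => ?_) fun x hx => ?_
    · exact measurable_const.mul ((hHm.comp (by fun_prop)).mul (hHm.comp (by fun_prop)))
    · rw [hk₀]
      simp only [abs_mul, abs_of_nonneg hκ, abs_of_nonneg (h0 _)]
      gcongr
      exacts [h0 _, h1 _, h1 _]
    · have ha := abs_le.1 (le_refl |a|)
      have hb := abs_le.1 (le_refl |b|)
      have ha' := abs_nonneg a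
      have hb' := abs_nonneg b
      rcases lt_abs.1 hx with h | h
      · have : N * (b - x) ≤ 1 := by nlinarith
        simp [hk₀, hH1 _ this]
      · have : N * (x - a) ≤ 1 := by nlinarith
        simp [hk₀, hH1 _ this]
  have layer : ∀ m : ℝ → ℝ, Measurable m → (∀ x, |m x| ≤ P + K * P) →
      Integrable fun x => β t * deriv H x * max (m x) 0 := by
    intro m hm hmb
    refine integrable_of_bounded_of_support (B := |β t| * B * (P + K * P)) (R := 2)
      ((measurable_const.mul hH').mul (hm.max measurable_const)) (fun x => ?_) fun x hx => ?_
    · rw [abs_mul, abs_mul]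
      gcongr
      exacts [hB x, abs_max_zero_le (hmb x)]
    · rcases lt_abs.1 hx with h | h
      · simp [hd2 x h.le]
      · simp [hd1 x (by linarith)]
  have i₁ : Integrable k₁ := layer _
    ((hGU (by fun_prop)).sub ((hΦU (by fun_prop)).const_mul p))
    fun x => abs_sub_mul_le (hGP _ _) (hΦP _ _) hp
  have i₂ : Integrable k₂ := layer _
    (((hΦU (by fun_prop)).const_mul q).sub (hGU (by fun_prop)))
    fun x => by rw [abs_sub_comm]; exact abs_sub_mul_le (hGP _ _) (hΦP _ _) hq
  have j₁ : Integrable fun x => N * k₁ (N * (x - a)) :=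
    ((i₁.comp_mul_left' hN.ne').comp_sub_right a).const_mul N
  have j₂ : Integrable fun x => N * k₂ (N * (b - x)) :=
    ((i₂.comp_mul_left' hN.ne').comp_sub_left b).const_mul N
  have hsplit : ∫ x, layerIntegrand κ Φ G U β H N a b p q t x =
      ∫ x, (k₀ x + (N * k₁ (N * (x - a)) + N * k₂ (N * (b - x)))) := by
    have e₁ : ∫ x, layerIntegrand κ Φ G U β H N a b p q t x =
        ∫ x, (k₀ x + (k₁ x + k₂ x)) := rfl
    rw [e₁, integral_add (g := fun x => k₁ x + k₂ x) i₀ (i₁.add i₂), integral_add i₁ i₂,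
      integral_add (g := fun x => N * k₁ (N * (x - a)) + N * k₂ (N * (b - x))) i₀ (j₁.add j₂),
      integral_add j₁ j₂, integral_rescale_right k₁ hN, integral_rescale_left k₂ hN]
  rw [hsplit]
  have hcm := (measurable_curveIntegrand hsol hΦ hG hβ hHs.continuous (a := fun _ => a)
    (b := fun _ => b) (p := fun _ => p) (q := fun _ => q) measurable_const measurable_const
    measurable_const measurable_const).comp (measurable_prodMk_left (x := t))
  have hs0 : ∀ s, 0 ≤ H (N * s) := fun s => h0 _
  refine integral_mono ?_ (i₀.add (j₁.add j₂)) fun x => ?_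
  · refine integrable_of_bounded_of_support (R := |a| + |b|) hcm
      (fun x => abs_curveIntegrand_le hΦP hGP hs0 (fun s => h1 _) (B := N * B) (fun s => ?_) hp hq
        (le_max_left |β t| |deriv β t|) (le_max_right _ _)) fun x hx => ?_
    · rw [hder, abs_mul, abs_of_pos hN]
      exact mul_le_mul_of_nonneg_left (hB _) hN.le
    · have ha := abs_le.1 (le_refl |a|)
      have hb := abs_le.1 (le_refl |b|)
      have ha' := abs_nonneg a
      have hb' := abs_nonneg b
      refine curveIntegrand_eq_zero hs0 (Or.inr ?_)
      rcases lt_abs.1 hx with h | h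
      · exact Or.inr (hH1 _ (by nlinarith))
      · exact Or.inl (hH1 _ (by nlinarith))
  · have ea : a + N * (x - a) / N = x := by field_simp; ring
    have eb : b - N * (b - x) / N = x := by field_simp; ring
    simp only [hk₀, hk₁, hk₂, ea, eb]
    unfold curveIntegrand
    simp only [hder]
    have t₀ : Φ (U x t) * deriv β t * (H (N * (x - a)) * H (N * (b - x))) ≤
        κ * deriv β t * (H (N * (x - a)) * H (N * (b - x))) :=
      mul_le_mul_of_nonneg_right (mul_le_mul_of_nonpos_right (hΦκ x t) hβ')
        (mul_nonneg (h0 _) (h0 _))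
    have aux : ∀ {g d r : ℝ}, 0 ≤ d → 0 ≤ r → r ≤ 1 → d * r * g ≤ d * max g 0 := by
      intro g d r hd hr hr1
      rw [mul_assoc]
      refine mul_le_mul_of_nonneg_left ?_ hd
      calc r * g ≤ r * max g 0 := mul_le_mul_of_nonneg_left (le_max_left _ _) hr
        _ ≤ 1 * max g 0 := mul_le_mul_of_nonneg_right hr1 (le_max_right _ _)
        _ = max g 0 := one_mul _
    have t₁ := mul_le_mul_of_nonneg_left (aux (g := G (U x t) - p * Φ (U x t))
      (mul_nonneg hN.le (hd (N * (x - a)))) (h0 (N * (b - x))) (h1 _)) hβ0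
    have t₂ := mul_le_mul_of_nonneg_left (aux (g := q * Φ (U x t) - G (U x t))
      (mul_nonneg hN.le (hd (N * (b - x)))) (h0 (N * (x - a))) (h1 _)) hβ0
    linarith

/-- Two Lipschitz curves along which the entropy `Φ > 0` is not produced from outside cannot
enclose a region between them. -/
lemma curves_ordered {A Φ G : ℝ → ℝ} {U Um Up : ℝ → ℝ → ℝ} (hsol : IsEntropySol A U)
    (hlim : HasSideLimits U Um Up)
    (hΦ : ContDiff ℝ (⊤ : ℕ∞) Φ) (hG : ContDiff ℝ (⊤ : ℕ∞) G)
    (hconv : ∀ v, 0 ≤ deriv (deriv Φ) v) (hflux : ∀ v, deriv G v = deriv Φ v * deriv A v)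
    (hpos : ∀ v, 0 < Φ v)
    {y z : ℝ → ℝ} {K : NNReal} (hy : LipschitzWith K y) (hz : LipschitzWith K z)
    (hy0 : ∀ t ≤ 0, y t = 0) (hz0 : ∀ t ≤ 0, z t = 0)
    (hyU : ∀ᵐ t, 0 < t → G (Up (y t) t) ≤ deriv y t * Φ (Up (y t) t))
    (hzU : ∀ᵐ t, 0 < t → deriv z t * Φ (Um (z t) t) ≤ G (Um (z t) t)) (t : ℝ) :
    z t ≤ y t := by
  by_contra! hlt
  have ht : 0 < t := by
    by_contra! h
    rw [hy0 t h, hz0 t h] at hlt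
    exact lt_irrefl _ hlt
  obtain ⟨M, hM⟩ := hsol.bounded
  have hcpt := isCompact_Icc (a := -M) (b := M)
  have hUM : ∀ x t, U x t ∈ Icc (-M) M := fun x t => abs_le.1 (hM x t)
  obtain ⟨v₀, -, hv₀⟩ := hcpt.exists_isMinOn ⟨U 0 0, hUM 0 0⟩ hΦ.continuous.continuousOn
  obtain ⟨P₁, hP₁⟩ := hcpt.exists_bound_of_continuousOn hΦ.continuous.continuousOn
  obtain ⟨P₂, hP₂⟩ := hcpt.exists_bound_of_continuousOn hG.continuous.continuousOn
  have hκ := hpos v₀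
  set κ := Φ v₀
  have hΦκ : ∀ x t, κ ≤ Φ (U x t) := fun x t => hv₀ (hUM x t)
  set P := max P₁ P₂
  have hΦP : ∀ x t, |Φ (U x t)| ≤ P := fun x t => (hP₁ _ (hUM x t)).trans (le_max_left _ _)
  have hGP : ∀ x t, |G (U x t)| ≤ P := fun x t => (hP₂ _ (hUM x t)).trans (le_max_right _ _)
  obtain ⟨H, B, hH, h0, h1, hH1, hH2, hd, hd2, hB⟩ := exists_smooth_step
  have hd1 : ∀ s ≤ 1, deriv H s = 0 := fun s hs =>
    deriv_eq_zero_of_nonneg_of_eq_zero h0 (hH1 s hs)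
  set T : ℝ := t + 1 with hT
  have hT0 : 0 ≤ T := by linarith
  obtain ⟨β, b, hβ, hβ0, hβT, hβT', hβn, hβn', hβb, hβb'⟩ := exists_smooth_time_cutoff T
  have hyd : ∀ s, |deriv y s| ≤ K := fun s => norm_deriv_le_of_lipschitz hy
  have hzd : ∀ s, |deriv z s| ≤ K := fun s => norm_deriv_le_of_lipschitz hz
  have hK : (0 : ℝ) ≤ K := K.coe_nonneg
  set R : ℝ := K * T + T + 2 with hR
  have hKT : 0 ≤ K * T := mul_nonneg hK hT0
  have hzero : ∀ N : ℝ, 0 < N → ∀ s x, 0 < s → (R < s ∨ R < |x|) →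
      (β s = 0 ∧ deriv β s = 0) ∨
        ((H (N * (x - y s)) = 0 ∨ H (N * (z s - x)) = 0) ∧ deriv H x = 0) := by
    intro N hN s x hs h
    rcases le_or_gt T s with hTs | hTs
    · exact Or.inl ⟨hβT s hTs, hβT' s hTs⟩
    · refine Or.inr ?_
      have hw : ∀ w : ℝ → ℝ, LipschitzWith K w → w 0 = 0 → |w s| ≤ K * T := by
        intro w hw hw0
        have h₁ : |w s| ≤ K * s := by simpa [hw0, abs_of_pos hs] using hw.dist_le_mul s 0
        exact h₁.trans (mul_le_mul_of_nonneg_left hTs.le hK)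
      have hy' := abs_le.1 (hw y hy (hy0 0 le_rfl))
      have hz' := abs_le.1 (hw z hz (hz0 0 le_rfl))
      rcases h with h | h
      · linarith
      · rcases lt_abs.1 h with h | h
        · exact ⟨Or.inr (hH1 _ (by nlinarith)), hd2 _ (by linarith)⟩
        · exact ⟨Or.inl (hH1 _ (by nlinarith)), hd1 _ (by linarith)⟩
  have hR0 : 0 ≤ R := by linarith
  have hNpos : ∀ n : ℕ, (0 : ℝ) < n + 1 := fun n => by positivity
  have hJm : ∀ n : ℕ, Measurable fun r : ℝ × ℝ => layerIntegrand κ Φ G U β H (n + 1)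
      (y r.1) (z r.1) (deriv y r.1) (deriv z r.1) r.1 r.2 := fun n =>
    measurable_layerIntegrand hsol hΦ.continuous hG.continuous hβ.continuous hH.continuous
      hy.continuous.measurable hz.continuous.measurable (measurable_deriv _) (measurable_deriv _) _ _
  have hJb : ∀ (n : ℕ) s x, 0 < s → |layerIntegrand κ Φ G U β H (n + 1)
      (y s) (z s) (deriv y s) (deriv z s) s x| ≤
      κ * b * (1 * 1) + (b * B * (P + K * P) + b * B * (P + K * P)) := fun n s x hs =>
    abs_layerIntegrand_le hκ.le hΦP hGP h0 h1 hB (hyd s) (hzd s) (hβb s hs.le) (hβb' s hs.le)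
  have hJz : ∀ (n : ℕ) s x, 0 < s → (R < s ∨ R < |x|) → layerIntegrand κ Φ G U β H (n + 1)
      (y s) (z s) (deriv y s) (deriv z s) s x = 0 := fun n s x hs h =>
    layerIntegrand_eq_zero (hzero _ (hNpos n) s x hs h)
  have hNtop : Tendsto (fun n : ℕ => (n : ℝ) + 1) atTop atTop :=
    tendsto_atTop_add_const_right _ _ tendsto_natCast_atTop_atTop
  have hdiv : ∀ x : ℝ, 0 < x → Tendsto (fun n : ℕ => x / ((n : ℝ) + 1)) atTop (𝓝[>] 0) :=
    fun x hx => tendsto_nhdsWithin_iff.2 ⟨hNtop.const_div_atTop x,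
      Eventually.of_forall fun n => div_pos hx (hNpos n)⟩
  have hlimit := tendsto_iterated_integral
    (g := fun s x => κ * deriv β s * (Ioo (y s) (z s)).indicator (fun _ => (1 : ℝ)) x)
    hJm hR0 hJb hJz (by
      filter_upwards [hyU, hzU] with s hys hzs hs x
      have first : Tendsto (fun n : ℕ => κ * deriv β s *
          (H (((n : ℝ) + 1) * (x - y s)) * H (((n : ℝ) + 1) * (z s - x)))) atTop
          (𝓝 (κ * deriv β s * (Ioo (y s) (z s)).indicator (fun _ => (1 : ℝ)) x)) := by
        refine tendsto_const_nhds.mul ?_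
        by_cases hx : x ∈ Ioo (y s) (z s)
        · rw [indicator_of_mem hx]
          refine tendsto_const_nhds.congr' ?_
          filter_upwards [(hNtop.atTop_mul_const (sub_pos.2 hx.1)).eventually_ge_atTop 2,
            (hNtop.atTop_mul_const (sub_pos.2 hx.2)).eventually_ge_atTop 2] with n h₁ h₂
          rw [hH2 _ h₁, hH2 _ h₂, one_mul]
        · rw [indicator_of_notMem hx]
          refine tendsto_const_nhds.congr fun n => ?_
          rcases le_or_gt x (y s) with h | h
          · rw [hH1 (((n : ℝ) + 1) * (x - y s)) (by nlinarith [hNpos n]), zero_mul]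
          · have h' : z s ≤ x := by
              by_contra! h'
              exact hx ⟨h, h'⟩
            rw [hH1 (((n : ℝ) + 1) * (z s - x)) (by nlinarith [hNpos n]), mul_zero]
      rcases le_or_gt x 0 with hx | hx
      · simpa [layerIntegrand, hd1 x (by linarith)] using first
      · have hr : Tendsto (fun n : ℕ => y s + x / ((n : ℝ) + 1)) atTop (𝓝[>] (y s)) := by
          refine tendsto_nhdsWithin_iff.2 ⟨?_, Eventually.of_forall fun n => ?_⟩
          · simpa using ((hdiv x hx).mono_right nhdsWithin_le_nhds).const_add (y s)
          · exact lt_add_of_pos_right _ (div_pos hx (hNpos n))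
        have hl : Tendsto (fun n : ℕ => z s - x / ((n : ℝ) + 1)) atTop (𝓝[<] (z s)) := by
          refine tendsto_nhdsWithin_iff.2 ⟨?_, Eventually.of_forall fun n => ?_⟩
          · simpa using ((hdiv x hx).mono_right nhdsWithin_le_nhds).const_sub (z s)
          · exact sub_lt_self _ (div_pos hx (hNpos n))
        have hUp := (hlim.right (y s) s hs).comp hr
        have hUm := (hlim.left (z s) s hs).comp hl
        have m₁ := (((hG.continuous.tendsto _).comp hUp).sub
          (((hΦ.continuous.tendsto _).comp hUp).const_mul (deriv y s))).max
          (tendsto_const_nhds (x := (0 : ℝ)))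
        have m₂ := ((((hΦ.continuous.tendsto _).comp hUm).const_mul (deriv z s)).sub
          ((hG.continuous.tendsto _).comp hUm)).max (tendsto_const_nhds (x := (0 : ℝ)))
        rw [max_eq_right (sub_nonpos.2 (hys hs))] at m₁
        rw [max_eq_right (sub_nonpos.2 (hzs hs))] at m₂
        have := first.add ((m₁.const_mul (β s * deriv H x)).add
          (m₂.const_mul (β s * deriv H x)))
        simp only [mul_zero, add_zero] at this
        exact this)
  have hnn : ∀ n : ℕ, 0 ≤ ∫ s in Ioi (0 : ℝ), ∫ x, layerIntegrand κ Φ G U β H (n + 1)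
      (y s) (z s) (deriv y s) (deriv z s) s x := by
    intro n
    have hN := hNpos n
    set N : ℝ := (n : ℝ) + 1
    have hHs : ContDiff ℝ (⊤ : ℕ∞) fun s => H (N * s) := hH.comp (contDiff_const.mul contDiff_id)
    have hBs : ∀ s, |deriv (fun s => H (N * s)) s| ≤ N * B := fun s => by
      rw [deriv_comp_mul_left, smul_eq_mul, abs_mul, abs_of_pos hN]
      exact mul_le_mul_of_nonneg_left (hB _) hN.le
    refine (entropy_along_lipschitz_curves hsol hΦ hG hconv hflux hΦP hGP hy hz hy0 hz0 hHs
      (fun s => h0 _) (fun s => h1 _) (c := 1 / N) (by positivity)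
      (fun s hs => hH1 _ (by rwa [mul_comm, ← le_div_iff₀ hN])) hBs
      hβ hβ0 hT0 hβT hβT' hβb hβb').trans ?_
    refine setIntegral_mono_on ?_ (integrableOn_iterated_integral (hJm n) hR0 (hJb n) (hJz n))
      measurableSet_Ioi fun s hs => integral_curveIntegrand_le hsol hΦ.continuous hG.continuous
        hβ.continuous hH hκ.le hΦκ hΦP hGP h0 h1 hH1 hd hd2 hB hN (hyd s) (hzd s) (hβ0 s) (hβn s)
    refine integrableOn_iterated_integral (R := R)
      (measurable_curveIntegrand hsol hΦ.continuous hG.continuous hβ.continuous hHs.continuous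
        hy.continuous.measurable hz.continuous.measurable (measurable_deriv _)
        (measurable_deriv _)) hR0
      (fun s x hs => abs_curveIntegrand_le hΦP hGP (fun s => h0 _) (fun s => h1 _) hBs (hyd s)
        (hzd s) (hβb s hs.le) (hβb' s hs.le))
      fun s x hs h => curveIntegrand_eq_zero (fun s => h0 _) ((hzero N hN s x hs h).imp_right And.left)
  have hfinal := ge_of_tendsto' hlimit hnn
  set w : ℝ → ℝ := fun s => κ * -deriv β s * max (z s - y s) 0 with hw
  have hinner : ∀ s, ∫ x, κ * deriv β s * (Ioo (y s) (z s)).indicator (fun _ => (1 : ℝ)) x =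
      -w s := by
    intro s
    rw [integral_const_mul, integral_indicator measurableSet_Ioo]
    simp [hw, Real.volume_real_Ioo]
  simp only [hinner, integral_neg, neg_nonneg] at hfinal
  have hw0 : ∀ s ∉ Icc 0 T, w s = 0 := by
    intro s hs
    rcases lt_or_ge s 0 with h | h
    · simp [hw, hy0 s h.le, hz0 s h.le]
    · have : T ≤ s := by
        by_contra! h'
        exact hs ⟨h, h'.le⟩
      simp [hw, hβT' s this]
  have hwI : ∫ s in Ioi (0 : ℝ), w s = ∫ s, w s :=
    setIntegral_eq_integral_of_forall_compl_eq_zero fun s hs => by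
      have h : s ≤ 0 := by simpa using hs
      simp [hw, hy0 s h, hz0 s h]
  have hwc : Continuous w :=
    (continuous_const.mul (continuous_deriv_of_smooth hβ).neg).mul
      ((hz.continuous.sub hy.continuous).max continuous_const)
  have hwpos : 0 < ∫ s, w s := by
    refine hwc.integral_pos_of_hasCompactSupport_nonneg_nonzero
      (HasCompactSupport.intro isCompact_Icc hw0)
      (fun s => mul_nonneg (mul_nonneg hκ.le (neg_nonneg.2 (hβn s))) (le_max_right _ _)) (x := t) ?_
    have h₁ : deriv β t < 0 := hβn' t (by linarith)
    exact (mul_pos (mul_pos hκ (neg_pos.2 h₁)) (lt_max_of_lt_left (sub_pos.2 hlt))).ne'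
  linarith

lemma IsFilippov.ae_deriv_extend {A η : ℝ → ℝ} {Um Up : ℝ → ℝ → ℝ} {C : ℝ} {x : ℝ → ℝ}
    (h : IsFilippov A η Um Up C (Ici 0) x) :
    ∀ᵐ t, 0 < t → normFlux A η (Up (x (max t 0)) t) C ≤ deriv (fun s => x (max s 0)) t ∧
      deriv (fun s => x (max s 0)) t ≤ normFlux A η (Um (x (max t 0)) t) C := by
  filter_upwards [(ae_restrict_iff' measurableSet_Ici).1 h.2] with t ht h0
  obtain ⟨d, hd, h₁, h₂⟩ := ht h0.le
  have he : (fun s => x (max s 0)) =ᶠ[𝓝 t] x := by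
    filter_upwards [lt_mem_nhds h0] with s hs
    rw [max_eq_left hs.le]
  rw [he.deriv_eq, hd.deriv, max_eq_left h0.le]
  exact ⟨h₁, h₂⟩

lemma lipschitzWith_extend {x : ℝ → ℝ} {K K' : NNReal} (h : LipschitzOnWith K x (Ici 0))
    (hK : K ≤ K') : LipschitzWith K' fun t => x (max t 0) := by
  refine LipschitzWith.of_dist_le_mul fun a b => ?_
  refine (h.dist_le_mul _ (le_max_right a 0) _ (le_max_right b 0)).trans
    (mul_le_mul hK ?_ dist_nonneg K'.coe_nonneg)
  rw [Real.dist_eq, Real.dist_eq]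
  exact abs_max_sub_max_le_abs a b 0

/-- **Proposition 3.6.** If `x_L, x_R : [0, ∞) → ℝ` are Filippov solutions of the
differential inclusions (3.10) with `x_L(0) = x_R(0) = 0` and `C_L > C_R`, then
`x_R(t) ≤ x_L(t)` for all `t ≥ 0`. -/
theorem curves_do_not_cross
    (A : ℝ → ℝ) (hA : ContDiff ℝ (⊤ : ℕ∞) A) (hA'' : ∀ x, 0 < deriv (deriv A) x)
    (U Um Up : ℝ → ℝ → ℝ)
    (hsol : IsEntropySol A U) (hlim : HasSideLimits U Um Up) (hcont : L1locCont U)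
    (η : ℝ → ℝ) (hη : ContDiff ℝ (⊤ : ℕ∞) η) (hconv : ∀ v, 0 < deriv (deriv η) v)
    (CL CR : ℝ) (hLR : CR < CL)
    (xL xR : ℝ → ℝ)
    (hFL : IsFilippov A η Um Up CL (Ici 0) xL)
    (hFR : IsFilippov A η Um Up CR (Ici 0) xR)
    (hL0 : xL 0 = 0) (hR0 : xR 0 = 0) :
    ∀ t : ℝ, 0 ≤ t → xR t ≤ xL t := by
  obtain ⟨⟨KL, hKL⟩, -⟩ := id hFL
  obtain ⟨⟨KR, hKR⟩, -⟩ := id hFR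
  have hΦd : ∀ v, HasDerivAt (fun v => relEnt η v CL + relEnt η v CR)
      ((deriv η v - deriv η CL) + (deriv η v - deriv η CR)) v := fun v =>
    (hasDerivAt_relEnt hη v CL).add (hasDerivAt_relEnt hη v CR)
  have hGd : ∀ v, HasDerivAt (fun v => relFlux A η v CL + relFlux A η v CR)
      ((deriv η v - deriv η CL) * deriv A v + (deriv η v - deriv η CR) * deriv A v) v := fun v =>
    (hasDerivAt_relFlux hA hη v CL).add (hasDerivAt_relFlux hA hη v CR)
  have hmono := fun v => normFlux_mono_right hA hA'' hη hconv v hLR.le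
  have h := curves_ordered (K := max KL KR) (y := fun t => xL (max t 0))
    (z := fun t => xR (max t 0)) hsol hlim
    ((contDiff_relEnt hη CL).add (contDiff_relEnt hη CR))
    ((contDiff_relFlux hA hη CL).add (contDiff_relFlux hA hη CR))
    (fun v => by
      have hη' := (hasDerivAt_of_smooth (contDiff_deriv_of_smooth hη) v)
      have e : HasDerivAt (fun v => deriv η v - deriv η CL + (deriv η v - deriv η CR))
          (deriv (deriv η) v + deriv (deriv η) v) v := (hη'.sub_const _).add (hη'.sub_const _)
      rw [show deriv (fun v => relEnt η v CL + relEnt η v CR) = _ from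
        funext fun v => (hΦd v).deriv, e.deriv]
      linarith [hconv v])
    (fun v => by
      rw [(hΦd v).deriv, (hGd v).deriv]
      ring)
    (fun v => by
      rcases eq_or_ne v CL with rfl | hv
      · exact add_pos_of_nonneg_of_pos (relEnt_nonneg hη hconv _ _) (relEnt_pos hη hconv hLR.ne')
      · exact add_pos_of_pos_of_nonneg (relEnt_pos hη hconv hv) (relEnt_nonneg hη hconv _ _))
    (lipschitzWith_extend hKL (le_max_left _ _)) (lipschitzWith_extend hKR (le_max_right _ _))
    (fun t ht => by simp [max_eq_right ht, hL0]) (fun t ht => by simp [max_eq_right ht, hR0])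
    (by
      filter_upwards [hFL.ae_deriv_extend] with t ht h0
      have h₁ := (ht h0).1
      rw [relFlux_eq_normFlux_mul hη hconv, relFlux_eq_normFlux_mul hη hconv, mul_add]
      exact add_le_add (mul_le_mul_of_nonneg_right h₁ (relEnt_nonneg hη hconv _ _))
        (mul_le_mul_of_nonneg_right ((hmono _).trans h₁) (relEnt_nonneg hη hconv _ _)))
    (by
      filter_upwards [hFR.ae_deriv_extend] with t ht h0
      have h₁ := (ht h0).2
      rw [relFlux_eq_normFlux_mul hη hconv, relFlux_eq_normFlux_mul hη hconv, mul_add]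
      exact add_le_add (mul_le_mul_of_nonneg_right (h₁.trans (hmono _))
        (relEnt_nonneg hη hconv _ _))
        (mul_le_mul_of_nonneg_right h₁ (relEnt_nonneg hη hconv _ _)))
  intro t ht
  simpa [max_eq_left ht] using h t
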